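/- Let X_1,...,X_d (d ≥ 2) and Y be discrete random variables with values in finite sets, jointly distributed with strictly positive pmf P. For a mother function μ (μ(i) < i for all i ∈ {2,...,d}, μ(2) = 1), let P_GNB(μ) be the Generalized Naive Bayes approximation P_GNB(μ)(x,y) = ( ∏_{i=2}^d P(y, x_{μ(i)}, x_i) ) / ( ∏_{i=3}^d P(y, x_{μ(i)}) ) and let W(μ) = Σ_{i=2}^d I(Y, X_{μ(i)}, X_i) − Σ_{i=3}^d I(Y, X_{μ(i)}) be its weight. Then for any two mother functions μ and μ′, KL(P ‖ P_GNB(μ)) ≤ KL(P ‖ P_GNB(μ′)) if and only if W(μ) ≥ W(μ′); in particular, a Generalized Naive Bayes structure minimizes the Kullback–Leibler divergence to P exactly when it maximizes the weight. -/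

import Mathlib

open scoped Classical BigOperators
open Real

noncomputable section

namespace GNB

variable {d : ℕ} {α : Fin d → Type} {β : Type} [∀ i, Fintype (α i)] [Fintype β]

/-- A joint configuration of the explanatory variables `X i` and the class variable `Y`. -/
abbrev Cfg (α : Fin d → Type) (β : Type) := ((i : Fin d) → α i) × β

/-- Marginal pmf of the class variable `Y`. -/
def margY (P : Cfg α β → ℝ) (y : β) : ℝ := ∑ x : (i : Fin d) → α i, P (x, y)

/-- Marginal pmf of the variable `X i`. -/
def margX (P : Cfg α β → ℝ) (i : Fin d) (a : α i) : ℝ :=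
  ∑ z : Cfg α β, if z.1 i = a then P z else 0

/-- Marginal pmf of the pair `(X i, Y)`. -/
def margXY (P : Cfg α β → ℝ) (i : Fin d) (a : α i) (y : β) : ℝ :=
  ∑ x : (i : Fin d) → α i, if x i = a then P (x, y) else 0

/-- Marginal pmf of the triplet `(X i, X j, Y)`. -/
def margXXY (P : Cfg α β → ℝ) (i j : Fin d) (a : α i) (b : α j) (y : β) : ℝ :=
  ∑ x : (i : Fin d) → α i, if x i = a ∧ x j = b then P (x, y) else 0

/-- Joint entropy `H(X_1,…,X_d,Y)`. -/
def HJoint (P : Cfg α β → ℝ) : ℝ := -∑ z : Cfg α β, P z * Real.log (P z)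

/-- Entropy `H(Y)`. -/
def HY (P : Cfg α β → ℝ) : ℝ := -∑ y : β, margY P y * Real.log (margY P y)

/-- Entropy `H(X i)`. -/
def HX (P : Cfg α β → ℝ) (i : Fin d) : ℝ :=
  -∑ a : α i, margX P i a * Real.log (margX P i a)

/-- Entropy `H(Y, X i)`. -/
def HYX (P : Cfg α β → ℝ) (i : Fin d) : ℝ :=
  -∑ y : β, ∑ a : α i, margXY P i a y * Real.log (margXY P i a y)

/-- Entropy `H(Y, X i, X j)`. -/
def HYXX (P : Cfg α β → ℝ) (i j : Fin d) : ℝ :=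
  -∑ y : β, ∑ a : α i, ∑ b : α j, margXXY P i j a b y * Real.log (margXXY P i j a b y)

/-- Mutual information `I(X i ; Y)`. -/
def IY2 (P : Cfg α β → ℝ) (i : Fin d) : ℝ :=
  ∑ y : β, ∑ a : α i, margXY P i a y *
    Real.log (margXY P i a y / (margX P i a * margY P y))

/-- Information content `I(Y, X i, X j)`. -/
def IY3 (P : Cfg α β → ℝ) (i j : Fin d) : ℝ :=
  ∑ y : β, ∑ a : α i, ∑ b : α j, margXXY P i j a b y *
    Real.log (margXXY P i j a b y / (margY P y * margX P i a * margX P j b))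

/-- Kullback–Leibler divergence `KL(p ‖ q)`. -/
def KL {γ : Type} [Fintype γ] (p q : γ → ℝ) : ℝ := ∑ c : γ, p c * Real.log (p c / q c)

/-- The Naive Bayes approximation `P_NB(x,y) = P(y) ∏ i, P(x i | y)`. -/
def PNB (P : Cfg α β → ℝ) : Cfg α β → ℝ :=
  fun z => margY P z.2 * ∏ i : Fin d, (margXY P i (z.1 i) z.2 / margY P z.2)

/-- The Generalized Naive Bayes approximation determined by the mother function `μ`:
`P_GNB(x,y) = (∏_{i=2}^d P(y, x_{μ i}, x_i)) / (∏_{i=3}^d P(y, x_{μ i}))`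
(indices are `0`-based: variable `X_k` of the paper is `X (k-1)` here). -/
def PGNB (P : Cfg α β → ℝ) (μ : Fin d → Fin d) : Cfg α β → ℝ :=
  fun z =>
    (∏ i ∈ Finset.univ.filter (fun i : Fin d => 1 ≤ (i : ℕ)),
        margXXY P (μ i) i (z.1 (μ i)) (z.1 i) z.2) /
    (∏ i ∈ Finset.univ.filter (fun i : Fin d => 2 ≤ (i : ℕ)),
        margXY P (μ i) (z.1 (μ i)) z.2)

/-- Predecessor on `Fin d` (truncated at `0`). -/
def pred (i : Fin d) : Fin d := ⟨(i : ℕ) - 1, lt_of_le_of_lt (Nat.sub_le _ _) i.isLt⟩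

end GNB

namespace GNB

section

variable {d : ℕ} {α : Fin d → Type} {β : Type} [∀ i, Fintype (α i)]

theorem margY_pos {P : Cfg α β → ℝ} (hpos : ∀ z, 0 < P z) (z : Cfg α β) :
    0 < margY P z.2 :=
  Finset.sum_pos' (fun _ _ => (hpos _).le) ⟨z.1, Finset.mem_univ _, hpos _⟩

theorem margXY_pos {P : Cfg α β → ℝ} (hpos : ∀ z, 0 < P z) (i : Fin d) (z : Cfg α β) :
    0 < margXY P i (z.1 i) z.2 := by
  refine Finset.sum_pos' (fun w _ => ?_) ⟨z.1, Finset.mem_univ _, ?_⟩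
  · split_ifs
    exacts [(hpos _).le, le_rfl]
  · simpa using hpos z

theorem margXXY_pos {P : Cfg α β → ℝ} (hpos : ∀ z, 0 < P z) (i j : Fin d) (z : Cfg α β) :
    0 < margXXY P i j (z.1 i) (z.1 j) z.2 := by
  refine Finset.sum_pos' (fun w _ => ?_) ⟨z.1, Finset.mem_univ _, ?_⟩
  · split_ifs
    exacts [(hpos _).le, le_rfl]
  · simpa using hpos z

theorem log_PGNB {P : Cfg α β → ℝ} (hpos : ∀ z, 0 < P z) (μ : Fin d → Fin d) (z : Cfg α β) :
    Real.log (PGNB P μ z) =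
      (∑ i ∈ Finset.univ.filter (fun i : Fin d => 1 ≤ (i : ℕ)),
        Real.log (margXXY P (μ i) i (z.1 (μ i)) (z.1 i) z.2)) -
      ∑ i ∈ Finset.univ.filter (fun i : Fin d => 2 ≤ (i : ℕ)),
        Real.log (margXY P (μ i) (z.1 (μ i)) z.2) := by
  rw [PGNB, Real.log_div
      (Finset.prod_pos fun i _ => margXXY_pos hpos (μ i) i z).ne'
      (Finset.prod_pos fun i _ => margXY_pos hpos (μ i) z).ne',
    Real.log_prod fun i _ => (margXXY_pos hpos (μ i) i z).ne',
    Real.log_prod fun i _ => (margXY_pos hpos (μ i) z).ne']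

theorem PGNB_pos {P : Cfg α β → ℝ} (hpos : ∀ z, 0 < P z) (μ : Fin d → Fin d) (z : Cfg α β) :
    0 < PGNB P μ z :=
  div_pos (Finset.prod_pos fun i _ => margXXY_pos hpos (μ i) i z)
    (Finset.prod_pos fun i _ => margXY_pos hpos (μ i) z)

variable [Fintype β]

theorem margX_pos {P : Cfg α β → ℝ} (hpos : ∀ z, 0 < P z) (i : Fin d) (z : Cfg α β) :
    0 < margX P i (z.1 i) := by
  refine Finset.sum_pos' (fun w _ => ?_) ⟨z, Finset.mem_univ _, ?_⟩
  · split_ifs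
    exacts [(hpos w).le, le_rfl]
  · simpa using hpos z

theorem sum_margXY_mul (P : Cfg α β → ℝ) (i : Fin d) (f : α i → β → ℝ) :
    ∑ y : β, ∑ a : α i, margXY P i a y * f a y = ∑ z : Cfg α β, P z * f (z.1 i) z.2 := by
  rw [Fintype.sum_prod_type_right]
  refine Finset.sum_congr rfl fun y _ => ?_
  simp only [margXY, Finset.sum_mul]
  rw [Finset.sum_comm]
  simp [ite_mul]

theorem sum_margXXY_mul (P : Cfg α β → ℝ) (i j : Fin d) (f : α i → α j → β → ℝ) :
    ∑ y : β, ∑ a : α i, ∑ b : α j, margXXY P i j a b y * f a b y =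
      ∑ z : Cfg α β, P z * f (z.1 i) (z.1 j) z.2 := by
  rw [Fintype.sum_prod_type_right]
  refine Finset.sum_congr rfl fun y _ => ?_
  simp only [margXXY, Finset.sum_mul]
  rw [Finset.sum_congr rfl fun a _ => Finset.sum_comm, Finset.sum_comm]
  simp [ite_mul, ite_and]

theorem IY2_eq_sum {P : Cfg α β → ℝ} (hpos : ∀ z, 0 < P z) (i : Fin d) :
    IY2 P i = ∑ z : Cfg α β, P z * (Real.log (margXY P i (z.1 i) z.2)
      - Real.log (margX P i (z.1 i)) - Real.log (margY P z.2)) := by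
  rw [IY2, sum_margXY_mul P i fun a y =>
    Real.log (margXY P i a y / (margX P i a * margY P y))]
  refine Finset.sum_congr rfl fun z _ => ?_
  have hX := (margX_pos hpos i z).ne'
  have hY := (margY_pos hpos z).ne'
  rw [Real.log_div (margXY_pos hpos i z).ne' (mul_ne_zero hX hY), Real.log_mul hX hY]
  ring

theorem IY3_eq_sum {P : Cfg α β → ℝ} (hpos : ∀ z, 0 < P z) (i j : Fin d) :
    IY3 P i j = ∑ z : Cfg α β, P z * (Real.log (margXXY P i j (z.1 i) (z.1 j) z.2)
      - Real.log (margX P i (z.1 i)) - Real.log (margY P z.2)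
      - Real.log (margX P j (z.1 j))) := by
  rw [IY3, sum_margXXY_mul P i j fun a b y =>
    Real.log (margXXY P i j a b y / (margY P y * margX P i a * margX P j b))]
  refine Finset.sum_congr rfl fun z _ => ?_
  have hi := (margX_pos hpos i z).ne'
  have hj := (margX_pos hpos j z).ne'
  have hY := (margY_pos hpos z).ne'
  rw [Real.log_div (margXXY_pos hpos i j z).ne' (mul_ne_zero (mul_ne_zero hY hi) hj),
    Real.log_mul (mul_ne_zero hY hi) hj, Real.log_mul hY hi]
  ring

theorem filter_one_le_eq_insert (hd : 2 ≤ d) :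
    Finset.univ.filter (fun i : Fin d => 1 ≤ (i : ℕ)) =
      insert ⟨1, hd⟩ (Finset.univ.filter (fun i : Fin d => 2 ≤ (i : ℕ))) := by
  ext i
  simp only [Finset.mem_filter, Finset.mem_univ, true_and, Finset.mem_insert, Fin.ext_iff]
  omega

/-- The divergence and the weight of a Generalized Naive Bayes structure add up to a quantity
that does not depend on the mother function. -/
theorem KL_add_weight {P : Cfg α β → ℝ} (hd : 2 ≤ d) (hpos : ∀ z, 0 < P z) {μ : Fin d → Fin d}
    (hμ : ∀ i : Fin d, 0 < (i : ℕ) → μ i < i) :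
    KL P (PGNB P μ) +
      ((∑ i ∈ Finset.univ.filter (fun i : Fin d => 1 ≤ (i : ℕ)), IY3 P (μ i) i)
        - ∑ i ∈ Finset.univ.filter (fun i : Fin d => 2 ≤ (i : ℕ)), IY2 P (μ i)) =
      ∑ z : Cfg α β, P z * (Real.log (P z) - Real.log (margY P z.2)
        - Real.log (margX P ⟨0, by omega⟩ (z.1 ⟨0, by omega⟩))
        - ∑ i ∈ Finset.univ.filter (fun i : Fin d => 1 ≤ (i : ℕ)),
            Real.log (margX P i (z.1 i))) := by
  have hroot : μ ⟨1, hd⟩ = ⟨0, by omega⟩ := by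
    have h := hμ ⟨1, hd⟩ Nat.one_pos
    rw [Fin.lt_def] at h
    exact Fin.ext (Nat.lt_one_iff.mp h)
  have hnotMem :
      (⟨1, hd⟩ : Fin d) ∉ Finset.univ.filter (fun i : Fin d => 2 ≤ (i : ℕ)) := by simp
  simp only [KL, IY3_eq_sum hpos, IY2_eq_sum hpos]
  rw [Finset.sum_comm, Finset.sum_comm (s := Finset.univ.filter fun i : Fin d => 2 ≤ (i : ℕ)),
    ← Finset.sum_sub_distrib, ← Finset.sum_add_distrib]
  refine Finset.sum_congr rfl fun z _ => ?_
  rw [Real.log_div (hpos z).ne' (PGNB_pos hpos μ z).ne', log_PGNB hpos,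
    ← Finset.mul_sum, ← Finset.mul_sum, ← mul_sub, ← mul_add, ← hroot]
  simp only [filter_one_le_eq_insert hd, Finset.sum_insert hnotMem, Finset.sum_sub_distrib]
  ring

end

end GNB

/-- Among Generalized Naive Bayes structures, minimizing the
Kullback–Leibler divergence to `P` is equivalent to maximizing the weight:
for any two mother functions `μ, μ'`,
`KL(P ‖ P_GNB(μ)) ≤ KL(P ‖ P_GNB(μ')) ↔ W(μ) ≥ W(μ')`, where
`W(μ) = Σ_{i=2}^d I(Y,X_{μ i},Xᵢ) − Σ_{i=3}^d I(Y,X_{μ i})` (`0`-based indices). -/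
theorem kl_le_iff_weight_ge (d : ℕ) (hd : 2 ≤ d) (α : Fin d → Type) (β : Type)
    [∀ i, Fintype (α i)] [∀ i, Nonempty (α i)] [Fintype β] [Nonempty β]
    (P : GNB.Cfg α β → ℝ) (hpos : ∀ z, 0 < P z) (hsum : ∑ z, P z = 1)
    (μ μ' : Fin d → Fin d)
    (hμ : ∀ i : Fin d, 0 < (i : ℕ) → μ i < i)
    (hμ' : ∀ i : Fin d, 0 < (i : ℕ) → μ' i < i) :
    GNB.KL P (GNB.PGNB P μ) ≤ GNB.KL P (GNB.PGNB P μ') ↔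
      (∑ i ∈ Finset.univ.filter (fun i : Fin d => 1 ≤ (i : ℕ)), GNB.IY3 P (μ' i) i)
        - (∑ i ∈ Finset.univ.filter (fun i : Fin d => 2 ≤ (i : ℕ)), GNB.IY2 P (μ' i)) ≤
      (∑ i ∈ Finset.univ.filter (fun i : Fin d => 1 ≤ (i : ℕ)), GNB.IY3 P (μ i) i)
        - (∑ i ∈ Finset.univ.filter (fun i : Fin d => 2 ≤ (i : ℕ)), GNB.IY2 P (μ i)) := by
  have h := GNB.KL_add_weight hd hpos hμ
  have h' := GNB.KL_add_weight hd hpos hμ'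
  constructor <;> intro hle <;> linarith
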